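/- arXiv:1910.07485 — 2 statements merged into one kernel-verified Lean document; each statement's English description precedes it below -/
import Mathlib

section
/- Let X₁,…,X_n be i.i.d. copies of X and f : S → ℝ measurable with 0 < Var(f(X)) < ∞. If E|f(X) − Ef(X)|^{2+δ} < ∞ for some δ ∈ [0,1], then there exist constants C′, C″ > 0 (depending only on the constant C₀ in the definition of g_f) such that for all t > 0, all n ≥ 1 and all Δ > 0: g_f(t,n) ≤ C′·E|f(X) − Ef(X)|^{2+δ} / ( n^{δ/2}·(σ(f) + t)^{2+δ} ) ≤ C′·E|f(X) − Ef(X)|^{2+δ} / ( n^{δ/2}·t^{2+δ} ), and G_f(n,Δ) ≤ C″·E|f(X) − Ef(X)|^{2+δ} / ( Δ^{2+δ}·n^{δ/2} ). -/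
open MeasureTheory ProbabilityTheory Real Set

noncomputable section

variable {S : Type*} [MeasurableSpace S]

/-- Mean of `g(X)` when `X ∼ P`. -/
def pMean (P : Measure S) (g : S → ℝ) : ℝ := ∫ x, g x ∂P

/-- Variance of `g(X)` when `X ∼ P`. -/
def pVar (P : Measure S) (g : S → ℝ) : ℝ := ∫ x, (g x - pMean P g) ^ 2 ∂P

/-- Standard deviation `σ(g)` of `g(X)` when `X ∼ P`. -/
def pSD (P : Measure S) (g : S → ℝ) : ℝ := Real.sqrt (pVar P g)

/-- The non-uniform Berry–Esseen majorant `g_g(t,n)` with absolute constant `C₀`. -/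
def gBE (C₀ : ℝ) (P : Measure S) (g : S → ℝ) (t : ℝ) (n : ℕ) : ℝ :=
  C₀ * ((∫ x in {x : S | pSD P g * Real.sqrt n * (1 + |t| / pSD P g) < |g x - pMean P g|},
          (g x - pMean P g) ^ 2 ∂P) / (pVar P g * (1 + |t| / pSD P g) ^ 2)
      + (Real.sqrt n)⁻¹ *
        (∫ x in {x : S | |g x - pMean P g| ≤ pSD P g * Real.sqrt n * (1 + |t| / pSD P g)},
          |g x - pMean P g| ^ 3 ∂P) / (pSD P g ^ 3 * (1 + |t| / pSD P g) ^ 3))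

/-- `G_g(n,Δ) = ∫₀^∞ g_g(Δ(1/2+t), n) dt`. -/
def GBE (C₀ : ℝ) (P : Measure S) (g : S → ℝ) (n : ℕ) (Δ : ℝ) : ℝ :=
  ∫ t in Set.Ioi (0 : ℝ), gBE C₀ P g (Δ * (1 / 2 + t)) n

lemma setIntegral_sq_le_of_lt_abs {P : Measure S} {h : S → ℝ} (hh : Measurable h) {δ L : ℝ}
    (hδ : 0 ≤ δ) (hL : 0 < L) (hint : Integrable (fun x => |h x| ^ (2 + δ)) P) :
    ∫ x in {x | L < |h x|}, h x ^ 2 ∂P ≤ (∫ x, |h x| ^ (2 + δ) ∂P) / L ^ δ := by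
  have hLδ : 0 < L ^ δ := rpow_pos_of_pos hL δ
  have hnonneg : ∀ x, 0 ≤ |h x| ^ (2 + δ) / L ^ δ := fun x => by positivity
  calc ∫ x in {x | L < |h x|}, h x ^ 2 ∂P
      ≤ ∫ x in {x | L < |h x|}, |h x| ^ (2 + δ) / L ^ δ ∂P := by
        refine integral_mono_of_nonneg (ae_of_all _ fun x => sq_nonneg _)
          (hint.div_const _).integrableOn
          (ae_restrict_of_forall_mem (measurableSet_lt measurable_const hh.abs) fun x hx => ?_)
        have hx0 : 0 < |h x| := hL.trans hx
        have hle : L ^ δ ≤ |h x| ^ δ := rpow_le_rpow hL.le (le_of_lt hx) hδ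
        rw [le_div_iff₀ hLδ, rpow_add hx0, rpow_two, sq_abs]
        gcongr
    _ ≤ ∫ x, |h x| ^ (2 + δ) / L ^ δ ∂P :=
        setIntegral_le_integral (hint.div_const _) (ae_of_all _ hnonneg)
    _ = (∫ x, |h x| ^ (2 + δ) ∂P) / L ^ δ := integral_div _ _

lemma setIntegral_abs_cube_le_of_abs_le {P : Measure S} {h : S → ℝ} (hh : Measurable h) {δ L : ℝ}
    (hδ : 0 ≤ δ) (hδ1 : δ ≤ 1) (hL : 0 < L)
    (hint : Integrable (fun x => |h x| ^ (2 + δ)) P) :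
    ∫ x in {x | |h x| ≤ L}, |h x| ^ 3 ∂P ≤ (∫ x, |h x| ^ (2 + δ) ∂P) * L ^ (1 - δ) := by
  have hnonneg : ∀ x, 0 ≤ |h x| ^ (2 + δ) * L ^ (1 - δ) := fun x => by positivity
  calc ∫ x in {x | |h x| ≤ L}, |h x| ^ 3 ∂P
      ≤ ∫ x in {x | |h x| ≤ L}, |h x| ^ (2 + δ) * L ^ (1 - δ) ∂P := by
        refine integral_mono_of_nonneg (ae_of_all _ fun x => by positivity)
          (hint.mul_const _).integrableOn
          (ae_restrict_of_forall_mem (measurableSet_le hh.abs measurable_const) fun x hx => ?_)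
        have hle : |h x| ^ (1 - δ) ≤ L ^ (1 - δ) :=
          rpow_le_rpow (abs_nonneg _) hx (by linarith)
        calc |h x| ^ 3 = |h x| ^ (2 + δ) * |h x| ^ (1 - δ) := by
              rw [← rpow_add_of_nonneg (abs_nonneg _) (by linarith) (by linarith),
                ← rpow_natCast]
              congr 1
              push_cast
              ring
          _ ≤ |h x| ^ (2 + δ) * L ^ (1 - δ) := by gcongr
    _ ≤ ∫ x, |h x| ^ (2 + δ) * L ^ (1 - δ) ∂P :=
        setIntegral_le_integral (hint.mul_const _) (ae_of_all _ hnonneg)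
    _ = (∫ x, |h x| ^ (2 + δ) ∂P) * L ^ (1 - δ) := integral_mul_const _ _

lemma gBE_le_of_integrable {C₀ : ℝ} (hC₀ : 0 ≤ C₀) {P : Measure S} {f : S → ℝ}
    (hf : Measurable f) (hV : 0 < pVar P f) {δ : ℝ} (hδ : 0 ≤ δ) (hδ1 : δ ≤ 1)
    (hint : Integrable (fun x => |f x - pMean P f| ^ (2 + δ)) P) (t : ℝ) {n : ℕ} (hn : 1 ≤ n) :
    gBE C₀ P f t n ≤ 2 * C₀ * (∫ x, |f x - pMean P f| ^ (2 + δ) ∂P) /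
      ((n : ℝ) ^ (δ / 2) * (pSD P f + |t|) ^ (2 + δ)) := by
  have hσ : 0 < pSD P f := Real.sqrt_pos.2 hV
  have hVσ : pVar P f = pSD P f ^ 2 := (Real.sq_sqrt hV.le).symm
  have hn0 : (0 : ℝ) < n := by exact_mod_cast hn
  have hq : 0 < √(n : ℝ) := Real.sqrt_pos.2 hn0
  have hh : Measurable fun x => f x - pMean P f := hf.sub_const _
  unfold gBE
  set M := ∫ x, |f x - pMean P f| ^ (2 + δ) ∂P
  set σ := pSD P f
  set s := σ + |t| with hs_def
  set q := √(n : ℝ)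
  have hs : 0 < s := by positivity
  have hL : 0 < q * s := mul_pos hq hs
  have hscale : σ * (1 + |t| / σ) = s := by rw [hs_def]; field_simp
  have hthr : σ * q * (1 + |t| / σ) = q * s := by rw [← hscale]; ring
  have hA := setIntegral_sq_le_of_lt_abs hh hδ hL hint
  have hB := setIntegral_abs_cube_le_of_abs_le hh hδ hδ1 hL hint
  have hnq : (n : ℝ) ^ (δ / 2) = q ^ δ := by
    rw [show q = (n : ℝ) ^ (1 / 2 : ℝ) from Real.sqrt_eq_rpow _, ← rpow_mul hn0.le]
    congr 1
    ring
  have hqδ : 0 < q ^ δ := rpow_pos_of_pos hq δ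
  have hsδ : 0 < s ^ δ := rpow_pos_of_pos hs δ
  rw [hthr, hVσ, ← mul_pow, ← mul_pow, hscale, hnq, rpow_add hs, rpow_two]
  rw [mul_rpow hq.le hs.le] at hA
  rw [rpow_sub hL, rpow_one, mul_rpow hq.le hs.le] at hB
  calc _ ≤ C₀ * (M / (q ^ δ * s ^ δ) / s ^ 2
          + q⁻¹ * (M * (q * s / (q ^ δ * s ^ δ))) / s ^ 3) := by gcongr
    _ = _ := by field_simp; ring

lemma integral_Ioi_half_add_rpow_neg_two :
    ∫ t in Ioi (0 : ℝ), (t + 1 / 2) ^ (-2 : ℝ) = 2 := by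
  have h := (measurePreserving_add_right volume (1 / 2 : ℝ)).setIntegral_preimage_emb
    (measurableEmbedding_addRight _) (fun t : ℝ => t ^ (-2 : ℝ)) (Ioi (1 / 2))
  rw [Set.preimage_add_const_Ioi, sub_self,
    integral_Ioi_rpow_of_lt (by norm_num) (by norm_num)] at h
  rw [h]
  norm_num [rpow_neg_one]

lemma gBE_nonneg {C₀ : ℝ} (hC₀ : 0 ≤ C₀) {P : Measure S} {f : S → ℝ} (hV : 0 ≤ pVar P f)
    (t : ℝ) (n : ℕ) : 0 ≤ gBE C₀ P f t n := by
  have hσ : 0 ≤ pSD P f := Real.sqrt_nonneg _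
  unfold gBE
  positivity

lemma GBE_le_of_integrable {C₀ : ℝ} (hC₀ : 0 ≤ C₀) {P : Measure S} {f : S → ℝ}
    (hf : Measurable f) (hV : 0 < pVar P f) {δ : ℝ} (hδ : 0 ≤ δ) (hδ1 : δ ≤ 1)
    (hint : Integrable (fun x => |f x - pMean P f| ^ (2 + δ)) P) {n : ℕ} (hn : 1 ≤ n)
    {Δ : ℝ} (hΔ : 0 < Δ) :
    GBE C₀ P f n Δ ≤ 8 * C₀ * (∫ x, |f x - pMean P f| ^ (2 + δ) ∂P) /
      (Δ ^ (2 + δ) * (n : ℝ) ^ (δ / 2)) := by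
  have hσ : 0 < pSD P f := Real.sqrt_pos.2 hV
  have hnδ : 0 < (n : ℝ) ^ (δ / 2) := rpow_pos_of_pos (by exact_mod_cast hn) _
  have hΔδ : 0 < Δ ^ (2 + δ) := rpow_pos_of_pos hΔ _
  have hbound : ∀ t : ℝ, 0 < t → gBE C₀ P f (Δ * (1 / 2 + t)) n ≤
      4 * C₀ * (∫ x, |f x - pMean P f| ^ (2 + δ) ∂P) / (Δ ^ (2 + δ) * (n : ℝ) ^ (δ / 2)) *
        (t + 1 / 2) ^ (-2 : ℝ) := by
    intro t ht
    have hM : 0 ≤ ∫ x, |f x - pMean P f| ^ (2 + δ) ∂P := by positivity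
    refine (gBE_le_of_integrable hC₀ hf hV hδ hδ1 hint _ hn).trans ?_
    set M := ∫ x, |f x - pMean P f| ^ (2 + δ) ∂P
    have hu : 0 < t + 1 / 2 := by linarith
    have hhalf : 1 / 2 ≤ (t + 1 / 2) ^ δ := calc
      (1 / 2 : ℝ) = (1 / 2) ^ (1 : ℝ) := (rpow_one _).symm
      _ ≤ (1 / 2) ^ δ := rpow_le_rpow_of_exponent_ge (by norm_num) (by norm_num) hδ1
      _ ≤ (t + 1 / 2) ^ δ := rpow_le_rpow (by norm_num) (by linarith) hδ
    have hlow : Δ ^ (2 + δ) * ((t + 1 / 2) ^ 2 * (1 / 2)) ≤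
        (pSD P f + |Δ * (1 / 2 + t)|) ^ (2 + δ) := calc
      _ ≤ Δ ^ (2 + δ) * ((t + 1 / 2) ^ 2 * (t + 1 / 2) ^ δ) := by gcongr
      _ = (Δ * (t + 1 / 2)) ^ (2 + δ) := by
        rw [mul_rpow hΔ.le hu.le, rpow_add hu, rpow_two]
      _ ≤ _ := by
        refine rpow_le_rpow (by positivity) ?_ (by linarith)
        rw [add_comm t, abs_of_pos (by positivity)]
        linarith
    calc 2 * C₀ * M / ((n : ℝ) ^ (δ / 2) * (pSD P f + |Δ * (1 / 2 + t)|) ^ (2 + δ))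
        ≤ 2 * C₀ * M / ((n : ℝ) ^ (δ / 2) * (Δ ^ (2 + δ) * ((t + 1 / 2) ^ 2 * (1 / 2)))) := by
          gcongr
      _ = _ := by
          rw [rpow_neg hu.le, rpow_two]
          field_simp
          ring
  calc GBE C₀ P f n Δ
      ≤ ∫ t in Ioi (0 : ℝ), 4 * C₀ * (∫ x, |f x - pMean P f| ^ (2 + δ) ∂P) /
          (Δ ^ (2 + δ) * (n : ℝ) ^ (δ / 2)) * (t + 1 / 2) ^ (-2 : ℝ) :=
        integral_mono_of_nonneg (ae_of_all _ fun t => gBE_nonneg hC₀ hV.le _ _)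
          ((integrableOn_add_rpow_Ioi_of_lt (by norm_num) (by norm_num)).const_mul _)
          (ae_restrict_of_forall_mem measurableSet_Ioi fun t ht => hbound t ht)
    _ = _ := by
        rw [integral_const_mul, integral_Ioi_half_add_rpow_neg_two]
        ring

/-- Lemma 2.1: bounds on the Berry–Esseen functionals `g_f` and `G_f` under a
`(2+δ)`-moment assumption; the constants depend only on the constant `C₀`. -/
theorem gBE_GBE_bounds (C₀ : ℝ) (hC₀ : 1 ≤ C₀) :
    ∃ C' C'' : ℝ, 0 < C' ∧ 0 < C'' ∧
      ∀ (S : Type) (_ : MeasurableSpace S) (P : Measure S), IsProbabilityMeasure P →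
      ∀ (f : S → ℝ), Measurable f → 0 < pVar P f →
      ∀ δ : ℝ, 0 ≤ δ → δ ≤ 1 →
        Integrable (fun x => |f x - pMean P f| ^ (2 + δ)) P →
        ∀ (t : ℝ), 0 < t → ∀ (n : ℕ), 1 ≤ n → ∀ (Δ : ℝ), 0 < Δ →
          gBE C₀ P f t n
              ≤ C' * (∫ x, |f x - pMean P f| ^ (2 + δ) ∂P) /
                ((n : ℝ) ^ (δ / 2) * (pSD P f + t) ^ (2 + δ)) ∧
          C' * (∫ x, |f x - pMean P f| ^ (2 + δ) ∂P) /
                ((n : ℝ) ^ (δ / 2) * (pSD P f + t) ^ (2 + δ))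
              ≤ C' * (∫ x, |f x - pMean P f| ^ (2 + δ) ∂P) /
                ((n : ℝ) ^ (δ / 2) * t ^ (2 + δ)) ∧
          GBE C₀ P f n Δ
              ≤ C'' * (∫ x, |f x - pMean P f| ^ (2 + δ) ∂P) /
                (Δ ^ (2 + δ) * (n : ℝ) ^ (δ / 2)) := by
  have hC : 0 < C₀ := by linarith
  refine ⟨2 * C₀, 8 * C₀, by positivity, by positivity, ?_⟩
  intro S _ P _ f hf hV δ hδ hδ1 hint t ht n hn Δ hΔ
  have hσ : 0 < pSD P f := Real.sqrt_pos.2 hV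
  have hnδ : 0 < (n : ℝ) ^ (δ / 2) := rpow_pos_of_pos (by exact_mod_cast hn) _
  refine ⟨?_, ?_, GBE_le_of_integrable hC.le hf hV hδ hδ1 hint hn hΔ⟩
  · simpa only [abs_of_pos ht] using gBE_le_of_integrable hC.le hf hV hδ hδ1 hint t hn
  · have hle : t ^ (2 + δ) ≤ (pSD P f + t) ^ (2 + δ) :=
      rpow_le_rpow ht.le (by linarith) (by linarith)
    gcongr

end
end

section
/- There exists a constant C(ρ) > 0 depending only on ρ such that for every f ∈ ℱ with E|ℓ(f(X)) − L(f)|³ < ∞ and σ(ℓ,f) > 0, every Δ > 0 and all positive integers n, k: |∂_z G_k(0;f)| ≥ (√(kn)/Δ)·( (1/(2√(2π)))·min( Δ/σ(ℓ,f), 2√(log 2) ) − (C(ρ)/√n)·E| (ℓ(f(X)) − L(f))/Δ |³ ), where ∂_z G_k(0;f) = −(√(kn)/Δ)·E ρ″( √n·(θ̄(f) − L(f))/Δ ). -/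
open MeasureTheory ProbabilityTheory Real Set

noncomputable section

variable {S : Type*} [MeasurableSpace S]

def Assumption1 (ρ : ℝ → ℝ) : Prop :=
  ConvexOn ℝ Set.univ ρ ∧ (∀ z, ρ (-z) = ρ z) ∧ ContDiff ℝ 5 ρ ∧
    (∀ z : ℝ, |z| ≤ 1 → deriv ρ z = z) ∧
    (∃ C : ℝ, ∀ z : ℝ, (2 : ℝ) ≤ z → deriv ρ z = C) ∧
    Monotone fun z => z - deriv ρ z

open scoped NNReal

/-- `ψ` is bounded and has the second order expansion with coefficients `a`, `b` at every point,
with a remainder that is cubic uniformly in the point. -/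
structure HasCubicRemainder (M : ℝ) (ψ a b : ℝ → ℝ) : Prop where
  measurable : Measurable ψ
  measurable_fst : Measurable a
  measurable_snd : Measurable b
  bounded : ∃ B, ∀ x, |ψ x| ≤ B ∧ |a x| ≤ B ∧ |b x| ≤ B
  remainder : ∀ x h, |ψ (x + h) - ψ x - a x * h - b x * h ^ 2 / 2| ≤ M * |h| ^ 3

lemma abs_sub_le_mul_abs_of_hasDerivAt {g g' : ℝ → ℝ} {C h : ℝ}
    (hg : ∀ t, HasDerivAt g (g' t) t) (hb : ∀ t, |t| ≤ |h| → |g' t| ≤ C) :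
    |g h - g 0| ≤ C * |h| := by
  have := (convex_Icc (-|h|) |h|).norm_image_sub_le_of_norm_hasDerivWithin_le (f := g) (f' := g')
    (C := C) (x := 0) (y := h) (fun t _ => (hg t).hasDerivWithinAt)
    (fun t ht => hb t (abs_le.2 ht)) ⟨neg_nonpos.2 (abs_nonneg h), abs_nonneg h⟩ (abs_le.1 le_rfl)
  simpa using this

lemma HasCubicRemainder.of_hasDerivAt {M B : ℝ} {ψ ψ₁ ψ₂ ψ₃ : ℝ → ℝ}
    (h₁ : ∀ x, HasDerivAt ψ (ψ₁ x) x) (h₂ : ∀ x, HasDerivAt ψ₁ (ψ₂ x) x)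
    (h₃ : ∀ x, HasDerivAt ψ₂ (ψ₃ x) x) (hM : ∀ x, |ψ₃ x| ≤ M)
    (hB : ∀ x, |ψ x| ≤ B ∧ |ψ₁ x| ≤ B ∧ |ψ₂ x| ≤ B) : HasCubicRemainder M ψ ψ₁ ψ₂ where
  measurable := (continuous_iff_continuousAt.2 fun x => (h₁ x).continuousAt).measurable
  measurable_fst := (continuous_iff_continuousAt.2 fun x => (h₂ x).continuousAt).measurable
  measurable_snd := (continuous_iff_continuousAt.2 fun x => (h₃ x).continuousAt).measurable
  bounded := ⟨B, hB⟩
  remainder x h := by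
    have hM0 : 0 ≤ M := (abs_nonneg _).trans (hM 0)
    have e₂ : ∀ t, |ψ₂ (x + t) - ψ₂ x| ≤ M * |t| := fun t => by
      simpa using abs_sub_le_mul_abs_of_hasDerivAt (g := fun t => ψ₂ (x + t)) (C := M) (h := t)
        (fun t => (h₃ (x + t)).comp_const_add x t) (fun t _ => hM _)
    have e₁ : ∀ t, |ψ₁ (x + t) - ψ₁ x - ψ₂ x * t| ≤ M * |t| ^ 2 := fun t => by
      have := abs_sub_le_mul_abs_of_hasDerivAt (g := fun t => ψ₁ (x + t) - ψ₂ x * t)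
        (C := M * |t|) (h := t)
        (fun t => ((h₂ (x + t)).comp_const_add x t).sub ((hasDerivAt_id t).const_mul (ψ₂ x)))
        (fun u hu => by
          simpa using (e₂ u).trans (mul_le_mul_of_nonneg_left hu hM0))
      calc _ = _ := by congr 1; simp; ring
        _ ≤ _ := this
        _ = _ := by ring
    have := abs_sub_le_mul_abs_of_hasDerivAt
      (g := fun t => ψ (x + t) - ψ₁ x * t - ψ₂ x * t ^ 2 / 2)
      (C := M * |h| ^ 2) (h := h)
      (fun t => (((h₁ (x + t)).comp_const_add x t).sub ((hasDerivAt_id t).const_mul (ψ₁ x))).sub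
        ((((hasDerivAt_id t).pow 2).const_mul (ψ₂ x)).div_const 2))
      (fun u hu => by
        refine le_trans (le_of_eq ?_) ((e₁ u).trans (mul_le_mul_of_nonneg_left
          (pow_le_pow_left₀ (abs_nonneg u) hu 2) hM0))
        congr 1; simp; ring)
    calc _ = _ := by congr 1; simp; ring
      _ ≤ _ := this
      _ = _ := by ring

lemma integrable_comp_of_abs_le {Ω : Type*} [MeasurableSpace Ω] {P : Measure Ω}
    [IsFiniteMeasure P] {ψ : ℝ → ℝ} (hψ : Measurable ψ) {B : ℝ} (hB : ∀ x, |ψ x| ≤ B)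
    {g : Ω → ℝ} (hg : Measurable g) : Integrable (fun ω => ψ (g ω)) P :=
  Integrable.of_bound (hψ.comp hg).aestronglyMeasurable B (ae_of_all _ fun _ => hB _)

lemma abs_integral_le_of_abs_le {Ω : Type*} [MeasurableSpace Ω] {P : Measure Ω}
    [IsProbabilityMeasure P] {u : Ω → ℝ} {B : ℝ} (hB : ∀ x, |u x| ≤ B) :
    |∫ ω, u ω ∂P| ≤ B := by
  simpa using norm_integral_le_of_norm_le_const (μ := P) (f := u) (ae_of_all _ hB)

lemma HasCubicRemainder.conv {M : ℝ} {ψ a b : ℝ → ℝ} (h : HasCubicRemainder M ψ a b)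
    (ν : Measure ℝ) [IsProbabilityMeasure ν] :
    HasCubicRemainder M (fun x => ∫ y, ψ (x + y) ∂ν) (fun x => ∫ y, a (x + y) ∂ν)
      (fun x => ∫ y, b (x + y) ∂ν) := by
  obtain ⟨B, hB⟩ := h.bounded
  have meas : ∀ {c : ℝ → ℝ}, Measurable c → Measurable fun x => ∫ y, c (x + y) ∂ν := fun hc =>
    (StronglyMeasurable.integral_prod_right'
      (f := fun p : ℝ × ℝ => _) (hc.comp measurable_add).stronglyMeasurable).measurable
  refine ⟨meas h.measurable, meas h.measurable_fst, meas h.measurable_snd, ⟨B, fun x =>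
    ⟨abs_integral_le_of_abs_le fun y => (hB _).1, abs_integral_le_of_abs_le fun y => (hB _).2.1,
      abs_integral_le_of_abs_le fun y => (hB _).2.2⟩⟩, fun x t => ?_⟩
  have i₀ : ∀ x, Integrable (fun y => ψ (x + y)) ν := fun x =>
    integrable_comp_of_abs_le h.measurable (fun x => (hB x).1) (measurable_const_add x)
  have i₁ : Integrable (fun y => a (x + y)) ν :=
    integrable_comp_of_abs_le h.measurable_fst (fun x => (hB x).2.1) (measurable_const_add x)
  have i₂ : Integrable (fun y => b (x + y)) ν :=
    integrable_comp_of_abs_le h.measurable_snd (fun x => (hB x).2.2) (measurable_const_add x)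
  have key : ∫ y, (ψ (x + t + y) - ψ (x + y) - a (x + y) * t - b (x + y) * t ^ 2 / 2) ∂ν
      = (∫ y, ψ (x + t + y) ∂ν) - (∫ y, ψ (x + y) ∂ν) - (∫ y, a (x + y) ∂ν) * t
        - (∫ y, b (x + y) ∂ν) * t ^ 2 / 2 := by
    have j₀ : Integrable (fun y => ψ (x + t + y) - ψ (x + y)) ν := (i₀ _).sub (i₀ _)
    have j₁ : Integrable (fun y => ψ (x + t + y) - ψ (x + y) - a (x + y) * t) ν :=
      j₀.sub (i₁.mul_const _)
    rw [integral_sub j₁ ((i₂.mul_const _).div_const _), integral_sub j₀ (i₁.mul_const _),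
      integral_sub (i₀ _) (i₀ _), integral_mul_const, integral_div, integral_mul_const]
  rw [← key]
  refine abs_integral_le_of_abs_le fun y => ?_
  have := h.remainder (x + y) t
  rwa [add_right_comm] at this

lemma integrable_of_integrable_abs_cube {Ω : Type*} [MeasurableSpace Ω] {P : Measure Ω}
    [IsFiniteMeasure P] {g : Ω → ℝ} (hg : Measurable g)
    (h : Integrable (fun ω => |g ω| ^ 3) P) : Integrable g P := by
  refine (h.add (integrable_const 1)).mono' hg.aestronglyMeasurable (ae_of_all _ fun ω => ?_)
  have := abs_nonneg (g ω)
  simp only [Real.norm_eq_abs, Pi.add_apply]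
  rcases le_total |g ω| 1 with h1 | h1
  · have := pow_nonneg this 3; linarith
  · have := le_self_pow₀ h1 (three_ne_zero); linarith

lemma integrable_sq_of_integrable_abs_cube {Ω : Type*} [MeasurableSpace Ω] {P : Measure Ω}
    [IsFiniteMeasure P] {g : Ω → ℝ} (hg : Measurable g)
    (h : Integrable (fun ω => |g ω| ^ 3) P) : Integrable (fun ω => g ω ^ 2) P := by
  refine (h.add (integrable_const 1)).mono' (hg.pow_const 2).aestronglyMeasurable
    (ae_of_all _ fun ω => ?_)
  have := abs_nonneg (g ω)
  simp only [Real.norm_eq_abs, Pi.add_apply, abs_pow]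
  rcases le_total |g ω| 1 with h1 | h1
  · have := pow_nonneg this 3
    have := pow_le_one₀ (n := 2) (abs_nonneg (g ω)) h1
    linarith
  · have := pow_le_pow_right₀ h1 (show 2 ≤ 3 by norm_num); linarith

/-- Expansion of `E ψ(x + g)` for a centered `g`, with cubic error. -/
lemma HasCubicRemainder.abs_integral_sub_le {M : ℝ} {ψ a b : ℝ → ℝ}
    (h : HasCubicRemainder M ψ a b) {Ω : Type*} [MeasurableSpace Ω] (P : Measure Ω)
    [IsProbabilityMeasure P] {g : Ω → ℝ} (hg : Measurable g)
    (h3 : Integrable (fun ω => |g ω| ^ 3) P) (h0 : ∫ ω, g ω ∂P = 0) (x : ℝ) :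
    |∫ ω, ψ (x + g ω) ∂P - ψ x - b x * (∫ ω, g ω ^ 2 ∂P) / 2| ≤ M * ∫ ω, |g ω| ^ 3 ∂P := by
  obtain ⟨B, hB⟩ := h.bounded
  have i₀ : Integrable (fun ω => ψ (x + g ω)) P :=
    integrable_comp_of_abs_le h.measurable (fun x => (hB x).1) (hg.const_add x)
  have i₁ := integrable_of_integrable_abs_cube hg h3
  have i₂ := integrable_sq_of_integrable_abs_cube hg h3
  have key : ∫ ω, (ψ (x + g ω) - ψ x - a x * g ω - b x * g ω ^ 2 / 2) ∂P
      = ∫ ω, ψ (x + g ω) ∂P - ψ x - b x * (∫ ω, g ω ^ 2 ∂P) / 2 := by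
    have j₀ : Integrable (fun ω => ψ (x + g ω) - ψ x) P := i₀.sub (integrable_const _)
    have j₁ : Integrable (fun ω => ψ (x + g ω) - ψ x - a x * g ω) P := j₀.sub (i₁.const_mul _)
    rw [integral_sub j₁ ((i₂.const_mul _).div_const _), integral_sub j₀ (i₁.const_mul _),
      integral_sub i₀ (integrable_const _), integral_div, integral_const_mul, integral_const_mul,
      h0]
    simp
  rw [← key, ← integral_const_mul]
  exact norm_integral_le_of_norm_le (h3.const_mul M)
    (f := fun ω => ψ (x + g ω) - ψ x - a x * g ω - b x * g ω ^ 2 / 2)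
    (ae_of_all _ fun ω => h.remainder x (g ω))

lemma integral_pi_succ {S : Type*} [MeasurableSpace S] (P : Measure S) [IsProbabilityMeasure P]
    (n : ℕ) {F : (Fin (n + 1) → S) → ℝ} (hF : Integrable F (Measure.pi fun _ => P)) :
    ∫ x, F x ∂(Measure.pi fun _ : Fin (n + 1) => P)
      = ∫ s, ∫ x, F (Fin.cons s x) ∂(Measure.pi fun _ : Fin n => P) ∂P := by
  have hm := (measurePreserving_piFinSuccAbove (fun _ : Fin (n + 1) => P) 0).symm
  rw [← hm.integral_comp', integral_prod]
  · simp_rw [MeasurableEquiv.piFinSuccAbove_symm_apply, Fin.insertNthEquiv]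
    simp
  · exact (hm.integrable_comp_emb (MeasurableEquiv.measurableEmbedding _)).2 hF

lemma integrable_abs_cube_gaussianReal (v : ℝ≥0) :
    Integrable (fun y : ℝ => |y| ^ 3) (gaussianReal 0 v) := by
  simpa using (memLp_id_gaussianReal (μ := 0) (v := v) 3).integrable_norm_pow (by norm_num)

lemma integral_sq_gaussianReal (v : ℝ≥0) : ∫ y : ℝ, y ^ 2 ∂(gaussianReal 0 v) = v := by
  rw [← variance_fun_id_gaussianReal (μ := 0) (v := v),
    variance_of_integral_eq_zero (by fun_prop) integral_id_gaussianReal]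

/-- Lindeberg's replacement bound. -/
lemma HasCubicRemainder.abs_integral_sum_sub_gaussian_le {M : ℝ} {ψ a b : ℝ → ℝ}
    (h : HasCubicRemainder M ψ a b) {S : Type*} [MeasurableSpace S] (P : Measure S)
    [IsProbabilityMeasure P] {g : S → ℝ} (hg : Measurable g)
    (h3 : Integrable (fun ω => |g ω| ^ 3) P) (h0 : ∫ ω, g ω ∂P = 0) (v : ℝ≥0)
    (hv : ∫ ω, g ω ^ 2 ∂P = v) (n : ℕ) (x : ℝ) :
    |∫ s, ψ (x + ∑ i, g (s i)) ∂(Measure.pi fun _ : Fin n => P)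
        - ∫ y, ψ (x + y) ∂(gaussianReal 0 (n * v))|
      ≤ n * (M * ∫ ω, |g ω| ^ 3 ∂P + M * ∫ y, |y| ^ 3 ∂(gaussianReal 0 v)) := by
  set c := M * ∫ ω, |g ω| ^ 3 ∂P + M * ∫ y, |y| ^ 3 ∂(gaussianReal 0 v) with hc
  obtain ⟨B, hB⟩ := h.bounded
  have hsum : ∀ m : ℕ, Measurable fun s : Fin m → S => ∑ i, g (s i) := fun m =>
    Finset.measurable_sum _ fun i _ => hg.comp (measurable_pi_apply i)
  induction n generalizing x with
  | zero => simp
  | succ n ih =>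
    have hψn := h.conv (gaussianReal 0 (n * v))
    have e₁ : ∫ s, ψ (x + ∑ i, g (s i)) ∂(Measure.pi fun _ : Fin (n + 1) => P)
        = ∫ t, ∫ s, ψ (x + g t + ∑ i, g (s i)) ∂(Measure.pi fun _ : Fin n => P) ∂P := by
      rw [integral_pi_succ P n (integrable_comp_of_abs_le h.measurable (fun x => (hB x).1)
        ((hsum _).const_add x))]
      simp [Fin.sum_univ_succ, add_assoc]
    have e₂ : ∫ y, ψ (x + y) ∂(gaussianReal 0 ((n + 1 : ℕ) * v))
        = ∫ t, ∫ y, ψ (x + t + y) ∂(gaussianReal 0 (n * v)) ∂(gaussianReal 0 v) := by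
      have : gaussianReal 0 ((n + 1 : ℕ) * v) = (gaussianReal 0 v) ∗ (gaussianReal 0 (n * v)) := by
        rw [gaussianReal_conv_gaussianReal]
        congr 1
        · simp
        · push_cast; ring
      rw [this, integral_conv (integrable_comp_of_abs_le h.measurable (fun x => (hB x).1)
        (measurable_const_add x))]
      simp [add_assoc]
    have d₁ : |∫ t, ∫ s, ψ (x + g t + ∑ i, g (s i)) ∂(Measure.pi fun _ : Fin n => P) ∂P
        - ∫ t, ∫ y, ψ (x + g t + y) ∂(gaussianReal 0 (n * v)) ∂P| ≤ n * c := by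
      rw [← integral_sub]
      · exact abs_integral_le_of_abs_le fun t => ih (x + g t)
      · refine Integrable.of_bound (C := B) ?_ (ae_of_all _ fun t =>
          abs_integral_le_of_abs_le fun s => (hB _).1)
        refine (StronglyMeasurable.integral_prod_right'
          (f := fun p : S × (Fin n → S) => ψ (x + g p.1 + ∑ i, g (p.2 i))) ?_).aestronglyMeasurable
        exact (h.measurable.comp (((hg.comp _root_.measurable_fst).const_add x).add
          ((hsum n).comp _root_.measurable_snd))).stronglyMeasurable
      · obtain ⟨B', hB'⟩ := hψn.bounded
        exact integrable_comp_of_abs_le hψn.measurable (fun x => (hB' x).1) (hg.const_add x)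
    have d₂ := hψn.abs_integral_sub_le P hg h3 h0 x
    have d₃ := hψn.abs_integral_sub_le (gaussianReal 0 v) measurable_id
      (integrable_abs_cube_gaussianReal v) integral_id_gaussianReal x
    simp only [id] at d₃
    rw [hv] at d₂
    rw [integral_sq_gaussianReal] at d₃
    rw [e₁, e₂]
    push_cast
    rw [abs_le] at *
    constructor <;> linarith [d₁.1, d₁.2, d₂.1, d₂.2, d₃.1, d₃.2]

lemma integral_abs_cube_gaussianReal (v : ℝ≥0) :
    ∫ y : ℝ, |y| ^ 3 ∂(gaussianReal 0 v)
      = Real.sqrt v ^ 3 * ∫ y : ℝ, |y| ^ 3 ∂(gaussianReal 0 1) := by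
  have : gaussianReal 0 v = (gaussianReal 0 1).map (Real.sqrt v * ·) := by
    rw [gaussianReal_map_const_mul]
    congr 1
    · simp
    · ext; simp
  rw [this, integral_map (by fun_prop) (by fun_prop), ← integral_const_mul]
  simp [abs_mul, mul_pow, abs_of_nonneg]

/-- Lyapunov's inequality between the second and the third absolute moment. -/
lemma sqrt_integral_sq_pow_le {Ω : Type*} [MeasurableSpace Ω] (P : Measure Ω)
    [IsProbabilityMeasure P] {g : Ω → ℝ} (hg : Measurable g)
    (h3 : Integrable (fun ω => |g ω| ^ 3) P) :
    Real.sqrt (∫ ω, g ω ^ 2 ∂P) ^ 3 ≤ ∫ ω, |g ω| ^ 3 ∂P := by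
  have i₂ := integrable_sq_of_integrable_abs_cube hg h3
  set s := Real.sqrt (∫ ω, g ω ^ 2 ∂P) with hs
  have hs0 : 0 ≤ s := Real.sqrt_nonneg _
  have hsq : s ^ 2 = ∫ ω, g ω ^ 2 ∂P := Real.sq_sqrt (integral_nonneg fun _ => sq_nonneg _)
  have : ∫ ω, 3 * s * g ω ^ 2 ∂P ≤ ∫ ω, (2 * |g ω| ^ 3 + s ^ 3) ∂P := by
    refine integral_mono (i₂.const_mul _) ((h3.const_mul 2).add (integrable_const _)) fun ω => ?_
    have hy := abs_nonneg (g ω)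
    simp only [← sq_abs (g ω)]
    nlinarith [mul_nonneg (sq_nonneg (|g ω| - s)) (by linarith : 0 ≤ 2 * |g ω| + s)]
  rw [integral_const_mul, integral_add (h3.const_mul 2) (integrable_const _), integral_const_mul,
    ← hsq] at this
  simp only [integral_const, probReal_univ, one_smul] at this
  nlinarith

lemma exp_neg_two_mul_log_two : Real.exp (-(2 * Real.log 2)) = 1 / 4 := by
  rw [Real.exp_neg, two_mul, Real.exp_add, Real.exp_log (by norm_num)]
  norm_num

lemma le_integral_gaussianReal {ψ : ℝ → ℝ} (hψ : Measurable ψ) {B : ℝ} (hB : ∀ x, |ψ x| ≤ B)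
    (h0 : ∀ x, 0 ≤ ψ x) (h1 : ∀ x, |x| < 1 → ψ x = 1) {s : ℝ} (hs : 0 < s) (v : ℝ≥0)
    (hv : (v : ℝ) = s ^ 2) :
    1 / (2 * Real.sqrt (2 * Real.pi)) * min (1 / s) (2 * Real.sqrt (Real.log 2))
      ≤ ∫ y, ψ y ∂(gaussianReal 0 v) := by
  set u := min (1 / s) (2 * Real.sqrt (Real.log 2))
  have hlog : 0 < Real.log 2 := Real.log_pos (by norm_num)
  have hu0 : 0 < u := lt_min (by positivity) (by positivity)
  have hus : u * s ≤ 1 := by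
    rw [← le_div_iff₀ hs]; exact min_le_left _ _
  have hu2 : u ^ 2 ≤ 4 * Real.log 2 := by
    calc u ^ 2 ≤ (2 * Real.sqrt (Real.log 2)) ^ 2 :=
          pow_le_pow_left₀ hu0.le (min_le_right _ _) 2
      _ = 4 * Real.log 2 := by rw [mul_pow, Real.sq_sqrt hlog.le]; norm_num
  have hv0 : v ≠ 0 := by
    rintro rfl
    exact (pow_pos hs 2).ne hv
  have hpdf : ∀ y ∈ Set.Ioo (-(u * s)) (u * s),
      1 / (Real.sqrt (2 * Real.pi) * s) * (1 / 4) ≤ gaussianPDFReal 0 v y := by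
    intro y hy
    have hy2 : y ^ 2 ≤ u ^ 2 * s ^ 2 := by
      rw [← mul_pow]; exact sq_le_sq' hy.1.le hy.2.le
    rw [gaussianPDFReal, hv, Real.sqrt_mul (by positivity : (0 : ℝ) ≤ 2 * Real.pi), Real.sqrt_sq hs.le, one_div]
    refine mul_le_mul_of_nonneg_left ?_ (by positivity)
    rw [← exp_neg_two_mul_log_two]
    refine Real.exp_le_exp.2 ?_
    rw [sub_zero, neg_div, neg_le_neg_iff, div_le_iff₀ (by positivity)]
    nlinarith [mul_le_mul_of_nonneg_right hu2 (sq_nonneg s)]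
  rw [integral_gaussianReal_eq_integral_smul hv0]
  have hint : Integrable (fun y => gaussianPDFReal 0 v y • ψ y) := by
    simp only [smul_eq_mul]
    exact (integrable_gaussianPDFReal 0 v).mul_bdd (c := B) hψ.aestronglyMeasurable (ae_of_all _ hB)
  calc _ = ∫ y in Set.Ioo (-(u * s)) (u * s), 1 / (Real.sqrt (2 * Real.pi) * s) * (1 / 4) := by
        rw [setIntegral_const, Real.volume_real_Ioo_of_le (by nlinarith [mul_pos hu0 hs])]
        simp only [smul_eq_mul]
        field_simp
        norm_num
    _ ≤ ∫ y in Set.Ioo (-(u * s)) (u * s), gaussianPDFReal 0 v y • ψ y := by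
        refine setIntegral_mono_on (integrableOn_const (by simp)) hint.integrableOn measurableSet_Ioo fun y hy => ?_
        rw [h1 y ((abs_lt.2 hy).trans_le hus), smul_eq_mul, mul_one]
        exact hpdf y hy
    _ ≤ _ := setIntegral_le_integral hint (ae_of_all _ fun y =>
        mul_nonneg (gaussianPDFReal_nonneg _ _ _) (h0 y))

lemma Assumption1.deriv_neg {ρ : ℝ → ℝ} (hρ : Assumption1 ρ) (z : ℝ) :
    deriv ρ (-z) = -deriv ρ z := by
  have := deriv_comp_neg ρ z
  rw [show (fun x => ρ (-x)) = ρ from funext hρ.2.1] at this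
  rw [this, neg_neg]

lemma Assumption1.exists_hasCubicRemainder {ρ : ℝ → ℝ} (hρ : Assumption1 ρ) :
    ∃ M a b, HasCubicRemainder M (deriv (deriv ρ)) a b := by
  have hodd := hρ.deriv_neg
  obtain ⟨-, -, hsmooth, -, ⟨C, hC⟩, -⟩ := hρ
  have hsupp : HasCompactSupport (deriv (deriv ρ)) := by
    refine HasCompactSupport.intro (isCompact_Icc (a := (-2 : ℝ)) (b := 2)) fun z hz => ?_
    rcases lt_or_ge z (-2) with h | h
    · have : deriv ρ =ᶠ[nhds z] fun _ => -C := by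
        filter_upwards [Iio_mem_nhds h] with y hy
        have := hC (-y) (by linarith [Set.mem_Iio.1 hy])
        rw [hodd] at this
        linarith
      rw [this.deriv_eq, deriv_const]
    · have h2 : 2 < z := not_le.1 fun h' => hz ⟨h, h'⟩
      have : deriv ρ =ᶠ[nhds z] fun _ => C := by
        filter_upwards [Ioi_mem_nhds h2] with y hy using hC y (le_of_lt hy)
      rw [this.deriv_eq, deriv_const]
  have h3 : ContDiff ℝ 3 (deriv (deriv ρ)) :=
    ContDiff.deriv' (n := 3) (ContDiff.deriv' (n := 4) (by norm_num; exact hsmooth))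
  have h2 : ContDiff ℝ 2 (deriv (deriv (deriv ρ))) := ContDiff.deriv' (by norm_num; exact h3)
  have h1 : ContDiff ℝ 1 (deriv (deriv (deriv (deriv ρ)))) :=
    ContDiff.deriv' (by norm_num; exact h2)
  obtain ⟨B₀, hB₀⟩ := hsupp.exists_bound_of_continuous h3.continuous
  obtain ⟨B₁, hB₁⟩ := hsupp.deriv.exists_bound_of_continuous h2.continuous
  obtain ⟨B₂, hB₂⟩ := hsupp.deriv.deriv.exists_bound_of_continuous h1.continuous
  obtain ⟨M, hM⟩ := hsupp.deriv.deriv.deriv.exists_bound_of_continuous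
    (h1.continuous_deriv le_rfl)
  refine ⟨M, _, _, HasCubicRemainder.of_hasDerivAt (B := max B₀ (max B₁ B₂))
    (fun x => (h3.differentiable (by norm_num) x).hasDerivAt)
    (fun x => (h2.differentiable (by norm_num) x).hasDerivAt)
    (fun x => (h1.differentiable (by norm_num) x).hasDerivAt) hM fun x => ⟨?_, ?_, ?_⟩⟩
  · exact (hB₀ x).trans (le_max_left _ _)
  · exact (hB₁ x).trans ((le_max_left _ _).trans (le_max_right _ _))
  · exact (hB₂ x).trans ((le_max_right _ _).trans (le_max_right _ _))

lemma Assumption1.hasDerivAt_deriv {ρ : ℝ → ℝ} (hρ : Assumption1 ρ) (x : ℝ) :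
    HasDerivAt (deriv ρ) (deriv (deriv ρ) x) x := by
  have h4 : ContDiff ℝ 4 (deriv ρ) := ContDiff.deriv' (n := 4) (by norm_num; exact hρ.2.2.1)
  exact (h4.differentiable (by norm_num) x).hasDerivAt

lemma Assumption1.exists_abs_deriv_le {ρ : ℝ → ℝ} (hρ : Assumption1 ρ) :
    ∃ B, ∀ x, |deriv ρ x| ≤ B := by
  have hcont : Continuous (deriv ρ) :=
    continuous_iff_continuousAt.2 fun x => (hρ.hasDerivAt_deriv x).continuousAt
  have hodd := hρ.deriv_neg
  obtain ⟨-, -, -, -, ⟨C, hC⟩, -⟩ := hρ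
  obtain ⟨B, hB⟩ := (isCompact_Icc (a := (-2 : ℝ)) (b := 2)).exists_bound_of_continuousOn
    hcont.continuousOn
  refine ⟨max B |C|, fun x => ?_⟩
  by_cases hx : x ∈ Set.Icc (-2 : ℝ) 2
  · exact (hB x hx).trans (le_max_left _ _)
  · refine le_trans (le_of_eq ?_) (le_max_right _ _)
    rcases lt_or_ge x (-2) with h | h
    · rw [← hC (-x) (by linarith), hodd, abs_neg]
    · rw [hC x (not_le.1 fun h' => hx ⟨h, h'⟩).le]

lemma Assumption1.deriv_deriv_nonneg {ρ : ℝ → ℝ} (hρ : Assumption1 ρ) (x : ℝ) :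
    0 ≤ deriv (deriv ρ) x := by
  have hdiff : Differentiable ℝ ρ := hρ.2.2.1.differentiable (by norm_num)
  have hmono : Monotone (deriv ρ) := fun x y hxy =>
    hρ.1.monotoneOn_deriv (fun z _ => hdiff z) (Set.mem_univ x) (Set.mem_univ y) hxy
  exact hmono.deriv_nonneg

lemma Assumption1.deriv_deriv_eq_one {ρ : ℝ → ℝ} (hρ : Assumption1 ρ) {x : ℝ} (hx : |x| < 1) :
    deriv (deriv ρ) x = 1 := by
  have : deriv ρ =ᶠ[nhds x] fun z => z := by
    filter_upwards [(isOpen_lt continuous_abs continuous_const).mem_nhds hx] with y hy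
      using hρ.2.2.2.1 y (le_of_lt hy)
  rw [this.deriv_eq, deriv_id'']

/-- Differentiation under the integral sign of a shifted expectation. -/
lemma hasDerivAt_integral_comp_sub_mul {Ω : Type*} [MeasurableSpace Ω] (P : Measure Ω)
    [IsProbabilityMeasure P] {φ φ' : ℝ → ℝ} (hφ : ∀ x, HasDerivAt φ (φ' x) x) {B B' : ℝ}
    (hB : ∀ x, |φ x| ≤ B) (hφ' : Measurable φ') (hB' : ∀ x, |φ' x| ≤ B') {Y : Ω → ℝ}
    (hY : Measurable Y) (c : ℝ) :
    HasDerivAt (fun z => ∫ ω, φ (Y ω - c * z) ∂P) (-c * ∫ ω, φ' (Y ω) ∂P) 0 := by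
  have hφm : Measurable φ :=
    (continuous_iff_continuousAt.2 fun x => (hφ x).continuousAt).measurable
  have := (hasDerivAt_integral_of_dominated_loc_of_deriv_le (μ := P) (𝕜 := ℝ) (x₀ := 0)
    (s := Set.univ)
    (F := fun z ω => φ (Y ω - c * z)) (F' := fun z ω => φ' (Y ω - c * z) * (-c))
    (bound := fun _ => B' * |c|) Filter.univ_mem
    (Filter.Eventually.of_forall fun z => (hφm.comp (hY.sub_const _)).aestronglyMeasurable)
    (integrable_comp_of_abs_le hφm hB (hY.sub_const _))
    ((hφ'.comp (hY.sub_const _)).mul_const _).aestronglyMeasurable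
    (ae_of_all _ fun ω z _ => ?_) (integrable_const _) (ae_of_all _ fun ω z _ => ?_)).2
  · exact this.congr_deriv (by rw [integral_mul_const, mul_comm]; simp)
  · rw [norm_mul, norm_neg]
    exact mul_le_mul_of_nonneg_right (hB' _) (abs_nonneg c)
  · have h := (hφ (Y ω - c * z)).comp z (((hasDerivAt_id z).const_mul c).const_sub (Y ω))
    exact h.congr_deriv (by simp)

/-- Lemma 7.4: lower bound on `|∂_z G_k(0;f)|`, where
`G_k(z;f) = √k · E ρ'(√n((θ̄(f) − L(f)) − z)/Δ)` and `θ̄(f)` is a block mean of `n` i.i.d.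
observations (formalized through the product measure `P^{⊗n}`). -/
theorem deriv_Gk_lower_bound (ρ : ℝ → ℝ) (hρ : Assumption1 ρ) :
    ∃ C : ℝ, 0 < C ∧
      ∀ (S : Type) (_ : MeasurableSpace S) (P : Measure S), IsProbabilityMeasure P →
      ∀ (f : S → ℝ), Measurable f →
      ∀ (ℓ : ℝ → ℝ), Measurable ℓ → (∀ x, 0 ≤ ℓ x) →
        0 < pSD P (fun x => ℓ (f x)) →
        Integrable (fun x => |ℓ (f x) - pMean P (fun y => ℓ (f y))| ^ 3) P →
      ∀ (Δ : ℝ), 0 < Δ → ∀ (n k : ℕ), 0 < n → 0 < k →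
        (Real.sqrt ((k : ℝ) * n) / Δ) *
            ((1 / (2 * Real.sqrt (2 * Real.pi))) *
                min (Δ / pSD P (fun x => ℓ (f x))) (2 * Real.sqrt (Real.log 2))
              - (C / Real.sqrt n) *
                  ∫ x, |(ℓ (f x) - pMean P (fun y => ℓ (f y))) / Δ| ^ 3 ∂P)
          ≤ |deriv (fun z : ℝ =>
              Real.sqrt k * ∫ x : Fin n → S,
                deriv ρ (Real.sqrt n *
                  (((n : ℝ)⁻¹ * ∑ i, ℓ (f (x i)) - pMean P (fun y => ℓ (f y))) - z) / Δ)
                ∂(Measure.pi fun _ : Fin n => P)) 0| := by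
  obtain ⟨M, a, b, hM⟩ := hρ.exists_hasCubicRemainder
  obtain ⟨B, hB⟩ := hρ.exists_abs_deriv_le
  obtain ⟨B', hB'⟩ := hM.bounded
  have hM0 : 0 ≤ M := by simpa using (abs_nonneg _).trans (hM.remainder 0 1)
  set c₃ := ∫ y : ℝ, |y| ^ 3 ∂(gaussianReal 0 1)
  have hc₃0 : 0 ≤ c₃ := integral_nonneg fun y => by positivity
  refine ⟨M * (1 + c₃) + 1, by positivity, ?_⟩
  intro S _ P hP f hf ℓ hℓ _ hσ h3 Δ hΔ n k hn hk
  set m := pMean P (fun y => ℓ (f y)) with hm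
  set σ := pSD P (fun x => ℓ (f x))
  have hn' : (0 : ℝ) < n := Nat.cast_pos.2 hn
  have hk' : (0 : ℝ) < k := Nat.cast_pos.2 hk
  have hsn : 0 < Real.sqrt n := Real.sqrt_pos.2 hn'
  have hsn2 : Real.sqrt n ^ 2 = n := Real.sq_sqrt hn'.le
  have hℓf : Measurable fun x => ℓ (f x) := hℓ.comp hf
  have hYi : Integrable (fun x => ℓ (f x) - m) P :=
    integrable_of_integrable_abs_cube (hℓf.sub_const m) h3
  have hℓi : Integrable (fun x => ℓ (f x)) P := by
    refine (hYi.add (integrable_const m)).congr (ae_of_all _ fun x => ?_)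
    simp
  have hY0 : ∫ x, (ℓ (f x) - m) ∂P = 0 := by
    rw [integral_sub hℓi (integrable_const m)]
    simp [hm, pMean]
  have hσ2 : σ ^ 2 = ∫ x, (ℓ (f x) - m) ^ 2 ∂P :=
    Real.sq_sqrt (integral_nonneg fun _ => sq_nonneg _)
  set d := (Real.sqrt n * Δ)⁻¹ with hd
  have hd0 : 0 < d := by positivity
  set g : S → ℝ := fun x => d * (ℓ (f x) - m) with hg
  have hgm : Measurable g := (hℓf.sub_const m).const_mul d
  have hg3 : (fun x => |g x| ^ 3) = fun x => d ^ 3 * |ℓ (f x) - m| ^ 3 := by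
    ext x; rw [hg, abs_mul, abs_of_pos hd0, mul_pow]
  have hgi : Integrable (fun x => |g x| ^ 3) P := hg3 ▸ h3.const_mul _
  have hg0 : ∫ x, g x ∂P = 0 := by rw [integral_const_mul, hY0, mul_zero]
  obtain ⟨v, hv⟩ : ∃ v : ℝ≥0, (v : ℝ) = (d * σ) ^ 2 := ⟨⟨_, sq_nonneg _⟩, rfl⟩
  have hvg : ∫ x, g x ^ 2 ∂P = v := by
    simp only [hg, hv, mul_pow, integral_const_mul, ← hσ2]
  set T := ∫ x, |(ℓ (f x) - m) / Δ| ^ 3 ∂P with hT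
  have hgT : ∫ x, |g x| ^ 3 ∂P = T / Real.sqrt n ^ 3 := by
    rw [hT, ← integral_div]
    congr 1
    ext x
    rw [← abs_of_pos (pow_pos hsn 3), abs_pow, ← div_pow, ← abs_div]
    congr 2
    simp only [hg, hd]
    field_simp
  have hT0 : 0 ≤ T := integral_nonneg fun x => by positivity
  have hgauss : ∫ y, |y| ^ 3 ∂(gaussianReal 0 v) ≤ c₃ * ∫ x, |g x| ^ 3 ∂P := by
    rw [integral_abs_cube_gaussianReal, mul_comm, ← hvg]
    exact mul_le_mul_of_nonneg_left (sqrt_integral_sq_pow_le P hgm hgi) hc₃0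
  have hlind := hM.abs_integral_sum_sub_gaussian_le P hgm hgi hg0 v hvg n 0
  have hlow := le_integral_gaussianReal hM.measurable (fun x => (hB' x).1)
    hρ.deriv_deriv_nonneg (fun x hx => hρ.deriv_deriv_eq_one hx) (s := σ / Δ) (by positivity)
    (n * v) (by
      rw [NNReal.coe_mul, NNReal.coe_natCast, hv, hd, mul_pow, inv_pow, mul_pow, hsn2]
      field_simp)
  rw [one_div_div] at hlow
  simp only [zero_add] at hlind
  set I := ∫ s, deriv (deriv ρ) (∑ i, g (s i)) ∂(Measure.pi fun _ : Fin n => P) with hI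
  have herr : n * (M * ∫ x, |g x| ^ 3 ∂P + M * ∫ y, |y| ^ 3 ∂(gaussianReal 0 v))
      ≤ (M * (1 + c₃) + 1) / Real.sqrt n * T := by
    calc _ ≤ n * (M * ∫ x, |g x| ^ 3 ∂P + M * (c₃ * ∫ x, |g x| ^ 3 ∂P)) := by gcongr
      _ = (M * (1 + c₃)) / Real.sqrt n * T := by
        rw [hgT]; nth_rw 1 [← hsn2]; field_simp
      _ ≤ _ := by gcongr; linarith
  have hderiv : HasDerivAt (fun z : ℝ => Real.sqrt k * ∫ x : Fin n → S,
      deriv ρ (Real.sqrt n * (((n : ℝ)⁻¹ * ∑ i, ℓ (f (x i)) - m) - z) / Δ)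
        ∂(Measure.pi fun _ : Fin n => P))
      (Real.sqrt k * (-(Real.sqrt n / Δ) * I)) 0 := by
    have hsum : Measurable fun s : Fin n → S => ∑ i, g (s i) :=
      Finset.measurable_sum _ fun i _ => hgm.comp (measurable_pi_apply i)
    have := (hasDerivAt_integral_comp_sub_mul (Measure.pi fun _ : Fin n => P)
      hρ.hasDerivAt_deriv hB hM.measurable (fun x => (hB' x).1) hsum
      (Real.sqrt n / Δ)).const_mul (Real.sqrt k)
    have e : ∀ (z : ℝ) (x : Fin n → S),
        Real.sqrt n * (((n : ℝ)⁻¹ * ∑ i, ℓ (f (x i)) - m) - z) / Δ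
          = ∑ i, g (x i) - Real.sqrt n / Δ * z := fun z x => by
      simp only [hg, hd, ← Finset.mul_sum, Finset.sum_sub_distrib, Finset.sum_const,
        Finset.card_univ, Fintype.card_fin, nsmul_eq_mul]
      field_simp
      rw [hsn2]
    simp only [e]
    exact this
  have hI0 : 0 ≤ I := integral_nonneg fun s => hρ.deriv_deriv_nonneg _
  rw [hderiv.deriv, show Real.sqrt k * (-(Real.sqrt n / Δ) * I)
    = -(Real.sqrt (k * n) / Δ * I) by rw [Real.sqrt_mul hk'.le]; ring, abs_neg,
    abs_of_nonneg (by positivity)]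
  refine mul_le_mul_of_nonneg_left ?_ (by positivity)
  have := (abs_le.1 hlind).1
  linarith

end
end
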